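/- Let G be a connected finite simple graph that is C_4-free (contains no induced cycle on four vertices), and suppose there exists a vertex u of G such that the subgraph of G induced on the closed neighbourhood N_G[u] = {u} ∪ N_G(u) satisfies χ_D(G[N_G[u]]) ≤ Δ(G). Then χ_D(G) ≤ Δ(G) + 1. -/

import Mathlib

open SimpleGraph

/-- A proper colouring `c` of `G` is distinguishing if the identity is the only
automorphism of `G` preserving `c`. -/
def SimpleGraph.IsDistinguishingColoring {V α : Type*} (G : SimpleGraph V)
    (c : G.Coloring α) : Prop :=
  ∀ φ : G ≃g G, (∀ v, c (φ v) = c v) → ∀ v, φ v = v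

/-- The distinguishing chromatic number of `G`: the least `k` such that `G` has a
proper vertex colouring with `k` colours preserved only by the identity automorphism. -/
noncomputable def SimpleGraph.distChromNum {V : Type*} (G : SimpleGraph V) : ℕ :=
  sInf {k | ∃ c : G.Coloring (Fin k), G.IsDistinguishingColoring c}

/-- The maximum degree of `G`, stated without decidability assumptions. -/
noncomputable def SimpleGraph.maxDeg {V : Type*} [Fintype V] (G : SimpleGraph V) : ℕ := by
  classical exact G.maxDegree

/-- `G` contains no induced subgraph isomorphic to `H`. -/
def SimpleGraph.IsFreeOf {V W : Type*} (G : SimpleGraph V) (H : SimpleGraph W) : Prop :=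
  ¬ Nonempty (H ↪g G)


/-- Colouring properties on a finite set `D` of already coloured vertices:
proper on `D`, and colour `none` occurs at `v ≠ u` only if `v` sees all other colours. -/
def S4Good {V : Type*} (G : SimpleGraph V) (u : V) (n : ℕ)
    (D : Finset V) (c : V → Option (Fin n)) : Prop :=
  (∀ x ∈ D, ∀ y ∈ D, G.Adj x y → c x ≠ c y) ∧
  (∀ v ∈ D, v ≠ u → c v = none → ∀ j : Fin n, ∃ x ∈ D, G.Adj v x ∧ c x = some j)

/-- Any automorphism fixing `u` and preserving a proper extension of `c` fixes `D`. -/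
def S4Fix {V : Type*} (G : SimpleGraph V) (u : V) (n : ℕ)
    (D : Finset V) (c : V → Option (Fin n)) : Prop :=
  ∀ c' : V → Option (Fin n), (∀ x y, G.Adj x y → c' x ≠ c' y) → (∀ v ∈ D, c' v = c v) →
    ∀ φ : G ≃g G, (∀ v, c' (φ v) = c' v) → φ u = u → ∀ v ∈ D, φ v = v

/-- Every vertex of `D` other than `u` has a neighbour all of whose neighbours are in `D`. -/
def S4Sat {V : Type*} (G : SimpleGraph V) (D : Finset V) : Prop :=
  ∀ v ∈ D, (∀ x, G.Adj v x → x ∈ D) ∨ ∃ q ∈ D, G.Adj v q ∧ ∀ x, G.Adj q x → x ∈ D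

/-- The neighbours of `w` in `D` form a clique. -/
def S4Clq {V : Type*} (G : SimpleGraph V) (D : Finset V) (w : V) : Prop :=
  ∀ x ∈ D, ∀ y ∈ D, G.Adj w x → G.Adj w y → x ≠ y → G.Adj x y

/-- Same neighbours in `D`. -/
def S4Twin {V : Type*} (G : SimpleGraph V) (D : Finset V) (w w' : V) : Prop :=
  ∀ x ∈ D, G.Adj w x ↔ G.Adj w' x

theorem s4_c4 {V : Type*} (G : SimpleGraph V) (hC4 : G.IsFreeOf (cycleGraph 4))
    (a b c d : V) (hab : G.Adj a b) (hbc : G.Adj b c) (hcd : G.Adj c d) (hda : G.Adj d a)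
    (hac : ¬ G.Adj a c) (hbd : ¬ G.Adj b d) (h1 : a ≠ c) (h2 : b ≠ d) : False := by
  apply hC4
  have e1 := hab.ne
  have e2 := hbc.ne
  have e3 := hcd.ne
  have e4 := hda.ne
  refine ⟨⟨⟨![a, b, c, d], ?_⟩, ?_⟩⟩
  · intro i j h
    fin_cases i <;> fin_cases j <;> simp_all
  · intro i j
    have hca : ¬ G.Adj c a := fun h => hac h.symm
    have hdb : ¬ G.Adj d b := fun h => hbd h.symm
    have s1 := hab.symm
    have s2 := hbc.symm
    have s3 := hcd.symm
    have s4 := hda.symm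
    have hl : ∀ x, ¬ G.Adj x x := fun x => G.loopless.irrefl x
    change G.Adj (![a, b, c, d] i) (![a, b, c, d] j) ↔ (cycleGraph 4).Adj i j
    have hdec : ∀ i j : Fin 4, (cycleGraph 4).Adj i j ↔ (i - j = 1 ∨ j - i = 1) :=
      fun i j => cycleGraph_adj
    rw [hdec]
    fin_cases i <;> fin_cases j <;>
      first
      | exact iff_of_false (hl _) (by decide)
      | exact iff_of_true (by assumption) (by decide)
      | exact iff_of_false (by assumption) (by decide)

/-- Choosing a colour for one more vertex. -/
theorem s4_choose {V : Type*} [Fintype V] [DecidableEq V] (G : SimpleGraph V)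
    [DecidableRel G.Adj] (n : ℕ)
    (hn : ∀ v, G.degree v ≤ n) (D A : Finset V) (c : V → Option (Fin n))
    (p q w : V) (hp : p ∈ D) (hq : q ∈ D) (hpq : G.Adj p q)
    (hqs : ∀ x, G.Adj q x → x ∈ D) (hA : ∀ x ∈ A, G.Adj p x ∧ x ∉ D)
    (hw : G.Adj p w) (hwD : w ∉ D) (hwA : w ∉ A) :
    ∃ k : Option (Fin n), (∀ x ∈ D ∪ A, G.Adj w x → c x ≠ k) ∧
      (k = none → ∀ j : Fin n, ∃ x ∈ D ∪ A, G.Adj w x ∧ c x = some j) ∧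
      (S4Clq G D w → ∀ x ∈ A, S4Twin G D w x → c x ≠ k) := by
  classical
  by_cases hc : S4Clq G D w
  · let F : Finset V := (D ∪ A).filter (fun x => G.Adj w x ∨ x ∈ A)
    have hF : F ⊆ insert p (((G.neighborFinset p).erase w).erase q) := by
      intro x hx
      simp only [F, Finset.mem_filter, Finset.mem_union] at hx
      simp only [Finset.mem_insert, Finset.mem_erase, mem_neighborFinset]
      by_cases hxp : x = p
      · exact Or.inl hxp
      right
      refine ⟨?_, ?_, ?_⟩
      · rintro rfl
        rcases hx.2 with h | h
        · exact hwD (hqs w h.symm)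
        · exact (hA x h).2 hq
      · rintro rfl
        rcases hx.1 with h | h
        · exact hwD h
        · exact hwA h
      · by_cases hxA : x ∈ A
        · exact (hA x hxA).1
        · have hxD : x ∈ D := hx.1.resolve_right hxA
          have hwx : G.Adj w x := hx.2.resolve_right hxA
          exact hc p hp x hxD hw.symm hwx (Ne.symm hxp)
    have hqw : q ≠ w := by rintro rfl; exact hwD hq
    have hcard : F.card < n := by
      have h1 := Finset.card_le_card hF
      have h2 := Finset.card_insert_le p (((G.neighborFinset p).erase w).erase q)
      have h3 : (((G.neighborFinset p).erase w).erase q).card + 1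
          = ((G.neighborFinset p).erase w).card :=
        Finset.card_erase_add_one (by simp [hqw, hpq])
      have h4 : ((G.neighborFinset p).erase w).card + 1 = (G.neighborFinset p).card :=
        Finset.card_erase_add_one (by simp [hw])
      have h5 := hn p
      rw [← card_neighborFinset_eq_degree] at h5
      omega
    have : ∃ j : Fin n, some j ∉ F.image c := by
      by_contra hcon
      push Not at hcon
      have hsub : (Finset.univ : Finset (Fin n)).map Function.Embedding.some ⊆ F.image c := by
        intro y hy
        simp only [Finset.mem_map, Finset.mem_univ, true_and] at hy
        obtain ⟨j, rfl⟩ := hy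
        exact hcon j
      have h1 := Finset.card_le_card hsub
      have h2 := Finset.card_image_le (s := F) (f := c)
      simp at h1
      omega
    obtain ⟨j, hj⟩ := this
    have hj' : ∀ x ∈ F, c x ≠ some j := fun x hx h =>
      hj (Finset.mem_image.2 ⟨x, hx, h⟩)
    refine ⟨some j, ?_, by simp, ?_⟩
    · intro x hx hwx
      exact hj' x (Finset.mem_filter.2 ⟨hx, Or.inl hwx⟩)
    · intro _ x hx _
      exact hj' x (Finset.mem_filter.2 ⟨Finset.mem_union_right _ hx, Or.inr hx⟩)
  · by_cases hex : ∃ j : Fin n, ∀ x ∈ D ∪ A, G.Adj w x → c x ≠ some j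
    · obtain ⟨j, hj⟩ := hex
      exact ⟨some j, hj, by simp, fun h => absurd h hc⟩
    · push Not at hex
      refine ⟨none, ?_, fun _ => hex, fun h => absurd h hc⟩
      intro x hx hwx hcx
      have hsub : (Finset.univ : Finset (Option (Fin n))) ⊆ (G.neighborFinset w).image c := by
        intro y _
        rw [Finset.mem_image]
        cases y with
        | none => exact ⟨x, by simpa using hwx, hcx⟩
        | some j =>
          obtain ⟨y, _, h1, h2⟩ := hex j
          exact ⟨y, by simpa using h1, h2⟩
      have h1 := Finset.card_le_card hsub
      have h2 := Finset.card_image_le (s := G.neighborFinset w) (f := c)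
      have h3 := hn w
      rw [card_neighborFinset_eq_degree] at h2
      simp at h1
      omega

/-- Colouring all the uncoloured neighbours of `p`. -/
theorem s4_inner {V : Type*} [Fintype V] [DecidableEq V] (G : SimpleGraph V)
    [DecidableRel G.Adj] (n : ℕ) (u : V)
    (hn : ∀ v, G.degree v ≤ n) (D : Finset V) (c : V → Option (Fin n))
    (hg : S4Good G u n D c)
    (p q : V) (hp : p ∈ D) (hq : q ∈ D) (hpq : G.Adj p q)
    (hqs : ∀ x, G.Adj q x → x ∈ D) (A : Finset V) :
    (∀ x ∈ A, G.Adj p x ∧ x ∉ D) →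
    ∃ c1 : V → Option (Fin n), (∀ v ∈ D, c1 v = c v) ∧ S4Good G u n (D ∪ A) c1 ∧
      ∀ x ∈ A, ∀ y ∈ A, x ≠ y → S4Twin G D x y → S4Clq G D x → c1 x ≠ c1 y := by
  induction A using Finset.induction_on with
  | empty => intro _; exact ⟨c, fun _ _ => rfl, by simpa using hg, by simp⟩
  | insert w A hwA ih =>
    intro hA
    obtain ⟨c1, h1, ⟨h2, h3⟩, h4⟩ := ih (fun x hx => hA x (Finset.mem_insert_of_mem hx))
    obtain ⟨hw, hwD⟩ := hA w (Finset.mem_insert_self _ _)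
    obtain ⟨k, k1, k2, k3⟩ := s4_choose G n hn D A c1 p q w hp hq hpq hqs
      (fun x hx => hA x (Finset.mem_insert_of_mem hx)) hw hwD hwA
    have hne : ∀ x ∈ D ∪ A, x ≠ w := by
      rintro x hx rfl
      rcases Finset.mem_union.1 hx with h | h
      · exact hwD h
      · exact hwA h
    have hup : ∀ x ∈ D ∪ A, Function.update c1 w k x = c1 x := fun x hx =>
      Function.update_of_ne (hne x hx) _ _
    have huA : ∀ x ∈ A, Function.update c1 w k x = c1 x := fun x hx =>
      hup x (Finset.mem_union_right _ hx)
    have hself : Function.update c1 w k w = k := Function.update_self _ _ _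
    refine ⟨Function.update c1 w k, ?_, ⟨?_, ?_⟩, ?_⟩
    · intro v hv
      rw [hup v (Finset.mem_union_left _ hv), h1 v hv]
    · intro x hx y hy hxy
      rw [Finset.union_insert, Finset.mem_insert] at hx hy
      rcases hx with rfl | hx <;> rcases hy with rfl | hy
      · exact absurd hxy (G.loopless.irrefl _)
      · rw [hself, hup y hy]; exact (k1 y hy hxy).symm
      · rw [hself, hup x hx]; exact k1 x hx hxy.symm
      · rw [hup x hx, hup y hy]; exact h2 x hx y hy hxy
    · intro v hv hvu hvn j
      rw [Finset.union_insert, Finset.mem_insert] at hv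
      have key : ∃ x ∈ D ∪ A, G.Adj v x ∧ c1 x = some j := by
        rcases hv with rfl | hv
        · rw [hself] at hvn
          exact k2 hvn j
        · rw [hup v hv] at hvn
          exact h3 v hv hvu hvn j
      obtain ⟨x, hx, hvx, hcx⟩ := key
      refine ⟨x, ?_, hvx, by rw [hup x hx, hcx]⟩
      rw [Finset.union_insert]
      exact Finset.mem_insert_of_mem hx
    · intro x hx y hy hxy ht hcl
      rw [Finset.mem_insert] at hx hy
      rcases hx with rfl | hx <;> rcases hy with rfl | hy
      · exact absurd rfl hxy
      · rw [hself, huA y hy]; exact (k3 hcl y hy ht).symm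
      · rw [hself, huA x hx]
        refine k3 ?_ x hx (fun z hz => (ht z hz).symm)
        intro a ha b hb hya hyb
        exact hcl a ha b hb ((ht a ha).2 hya) ((ht b hb).2 hyb)
      · rw [huA x hx, huA y hy]; exact h4 x hx y hy hxy ht hcl

theorem s4_step {V : Type*} [Fintype V] [DecidableEq V] (G : SimpleGraph V)
    [DecidableRel G.Adj] (hC4 : G.IsFreeOf (cycleGraph 4)) (n : ℕ) (u : V)
    (hn : ∀ v, G.degree v ≤ n) (D : Finset V) (c : V → Option (Fin n))
    (hg : S4Good G u n D c) (hf : S4Fix G u n D c) (hs : S4Sat G D)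
    (p w : V) (hp : p ∈ D) (hpw : G.Adj p w) (hw : w ∉ D) :
    ∃ D1 : Finset V, ∃ c1 : V → Option (Fin n), D ⊂ D1 ∧ (∀ v ∈ D, c1 v = c v) ∧
      S4Good G u n D1 c1 ∧ S4Fix G u n D1 c1 ∧ S4Sat G D1 := by
  obtain ⟨q, hq, hpq, hqs⟩ := (hs p hp).resolve_left (fun h => hw (h w hpw))
  have hK : ∀ x, x ∈ G.neighborFinset p \ D ↔ G.Adj p x ∧ x ∉ D := by
    intro x; simp
  obtain ⟨c1, h1, h2, h3⟩ := s4_inner G n u hn D c hg p q hp hq hpq hqs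
    (G.neighborFinset p \ D) (fun x hx => (hK x).1 hx)
  refine ⟨D ∪ (G.neighborFinset p \ D), c1, ?_, h1, h2, ?_, ?_⟩
  · refine Finset.ssubset_iff_subset_ne.2 ⟨Finset.subset_union_left, ?_⟩
    intro h
    apply hw
    rw [h]
    exact Finset.mem_union_right _ ((hK w).2 ⟨hpw, hw⟩)
  · intro c' hprop hext φ hφ hφu
    have hD : ∀ v ∈ D, φ v = v := hf c' hprop
      (fun v hv => by rw [hext v (Finset.mem_union_left _ hv), h1 v hv]) φ hφ hφu
    intro v hv
    rcases Finset.mem_union.1 hv with hv | hvK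
    · exact hD v hv
    obtain ⟨hpv, hvD⟩ := (hK v).1 hvK
    by_contra hne
    have hadj : ∀ x ∈ D, (G.Adj v x ↔ G.Adj (φ v) x) := by
      intro x hx
      have := φ.map_adj_iff (v := v) (w := x)
      rw [hD x hx] at this
      exact this.symm
    have hpv' : G.Adj p (φ v) := ((hadj p hp).1 hpv.symm).symm
    have hvD' : φ v ∉ D := fun h => hne (φ.injective (hD _ h))
    have hvK' := (hK _).2 ⟨hpv', hvD'⟩
    have hnadj : ¬ G.Adj v (φ v) := fun h => hprop _ _ h (hφ v).symm
    refine h3 v hvK (φ v) hvK' (Ne.symm hne) hadj ?_ ?_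
    · intro x hx y hy hvx hvy hxy
      by_contra hxy'
      exact s4_c4 G hC4 v x (φ v) y hvx ((hadj x hx).1 hvx).symm ((hadj y hy).1 hvy) hvy.symm
        hnadj hxy' (Ne.symm hne) hxy
    · rw [← hext _ (Finset.mem_union_right _ hvK), ← hext _ (Finset.mem_union_right _ hvK'), hφ]
  · intro v hv
    rcases Finset.mem_union.1 hv with hv | hvK
    · rcases hs v hv with h | ⟨r, hr, hvr, h⟩
      · exact Or.inl fun x hx => Finset.mem_union_left _ (h x hx)
      · exact Or.inr ⟨r, Finset.mem_union_left _ hr, hvr,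
          fun x hx => Finset.mem_union_left _ (h x hx)⟩
    · refine Or.inr ⟨p, Finset.mem_union_left _ hp, ((hK v).1 hvK).1.symm, ?_⟩
      intro x hx
      by_cases hxD : x ∈ D
      · exact Finset.mem_union_left _ hxD
      · exact Finset.mem_union_right _ ((hK x).2 ⟨hx, hxD⟩)

theorem s4_iter {V : Type*} [Fintype V] [DecidableEq V] (G : SimpleGraph V)
    [DecidableRel G.Adj] (hconn : G.Connected)
    (hC4 : G.IsFreeOf (cycleGraph 4)) (n : ℕ) (u : V)
    (hn : ∀ v, G.degree v ≤ n) (m : ℕ) : ∀ (D : Finset V) (c : V → Option (Fin n)),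
    u ∈ D → S4Good G u n D c → S4Fix G u n D c → S4Sat G D → Fintype.card V ≤ D.card + m →
    ∃ c1 : V → Option (Fin n), (∀ v ∈ D, c1 v = c v) ∧
      S4Good G u n Finset.univ c1 ∧ S4Fix G u n Finset.univ c1 := by
  induction m with
  | zero =>
    intro D c hu hg hf hs hm
    have : D = Finset.univ := by
      rw [← Finset.card_eq_iff_eq_univ]
      exact le_antisymm (Finset.card_le_univ D) hm
    subst this
    exact ⟨c, fun _ _ => rfl, hg, hf⟩
  | succ m ih =>
    intro D c hu hg hf hs hm
    by_cases hD : ∃ w, w ∉ D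
    · obtain ⟨w, hw⟩ := hD
      obtain ⟨W⟩ := hconn.preconnected u w
      obtain ⟨d, _, hd1, hd2⟩ := W.exists_boundary_dart (D : Set V) (by simpa using hu)
        (by simpa using hw)
      obtain ⟨D1, c1, hlt, h1, h2, h3, h4⟩ := s4_step G hC4 n u hn D c hg hf hs d.fst d.snd
        (by simpa using hd1) d.adj (by simpa using hd2)
      have hcard := Finset.card_lt_card hlt
      obtain ⟨c2, k1, k2, k3⟩ := ih D1 c1 (hlt.1 hu) h2 h3 h4 (by omega)
      exact ⟨c2, fun v hv => by rw [k1 v (hlt.1 hv), h1 v hv], k2, k3⟩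
    · push Not at hD
      have : D = Finset.univ := Finset.eq_univ_iff_forall.2 hD
      subst this
      exact ⟨c, fun _ _ => rfl, hg, hf⟩

theorem s4_attained {V : Type*} [Finite V] (G : SimpleGraph V) :
    ∃ c : G.Coloring (Fin G.distChromNum), G.IsDistinguishingColoring c := by
  have hne : {k | ∃ c : G.Coloring (Fin k), G.IsDistinguishingColoring c}.Nonempty := by
    obtain ⟨k, ⟨e⟩⟩ := Finite.exists_equiv_fin V
    refine ⟨k, Coloring.mk e (fun h he => h.ne (e.injective he)), ?_⟩
    intro φ hφ v
    exact e.injective (hφ v)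
  exact Nat.sInf_mem hne

theorem s4_base {V : Type*} [Fintype V] [DecidableEq V] (G : SimpleGraph V)
    [DecidableRel G.Adj] (n : ℕ) (u : V)
    (c0 : V → Fin n)
    (hprop : ∀ x y, x ∈ insert u (G.neighborSet u) → y ∈ insert u (G.neighborSet u) →
      G.Adj x y → c0 x ≠ c0 y)
    (hdist : ∀ φ : G.induce (insert u (G.neighborSet u)) ≃g G.induce (insert u (G.neighborSet u)),
      (∀ v, c0 (φ v) = c0 v) → ∀ v, φ v = v) :
    ∃ (D : Finset V) (c : V → Option (Fin n)), u ∈ D ∧ S4Good G u n D c ∧ S4Fix G u n D c ∧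
      S4Sat G D ∧ (∀ x, G.Adj u x → x ∈ D ∧ c x ≠ some (c0 u)) ∧ c u = none := by
  have hmem : ∀ x, x ∈ insert u (G.neighborFinset u) ↔ x ∈ insert u (G.neighborSet u) := by
    intro x; simp
  have hS : ∀ x, x ∈ insert u (G.neighborSet u) ↔ x = u ∨ G.Adj u x := by
    intro x; simp
  have huS : u ∈ insert u (G.neighborSet u) := by simp
  refine ⟨insert u (G.neighborFinset u), fun v => if v = u then none else some (c0 v),
    by simp, ⟨?_, ?_⟩, ?_, ?_, ?_, by simp⟩
  · intro x hx y hy hxy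
    rw [hmem] at hx hy
    have := hprop x y hx hy hxy
    have hne := hxy.ne
    by_cases h1 : x = u <;> by_cases h2 : y = u <;> simp_all
  · intro v _ hvu hv
    simp [hvu] at hv
  · intro c' _ hext φ hφ hφu v hv
    have himg : ∀ x, x ∈ insert u (G.neighborSet u) ↔ φ x ∈ insert u (G.neighborSet u) := by
      intro x
      rw [hS, hS]
      have h1 : G.Adj u (φ x) ↔ G.Adj u x := by
        have := φ.map_adj_iff (v := u) (w := x)
        rwa [hφu] at this
      have h2 : φ x = u ↔ x = u := by
        constructor
        · intro h; exact φ.injective (h.trans hφu.symm)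
        · rintro rfl; exact hφu
      rw [h1, h2]
    let ψ : G.induce (insert u (G.neighborSet u)) ≃g G.induce (insert u (G.neighborSet u)) :=
      ⟨φ.toEquiv.subtypeEquiv himg, by
        intro a b
        exact φ.map_adj_iff⟩
    have hψ : ∀ x, ((ψ x : _) : V) = φ x := fun x => rfl
    have h := hdist ψ (by
      rintro ⟨x, hx⟩
      rw [hψ]
      by_cases hxu : x = u
      · subst hxu; simp [hφu]
      have hxu' : φ x ≠ u := fun h => hxu (φ.injective (h.trans hφu.symm))
      have e1 := hext x ((hmem x).2 hx)
      have e2 := hext (φ x) ((hmem _).2 ((himg x).1 hx))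
      rw [hφ, e1] at e2
      simp only [hxu, hxu', if_false] at e2
      exact (Option.some.inj e2).symm) ⟨v, (hmem v).1 hv⟩
    have := congrArg Subtype.val h
    rwa [hψ] at this
  · intro v hv
    rw [hmem, hS] at hv
    have hus : ∀ x, G.Adj u x → x ∈ insert u (G.neighborFinset u) := by
      intro x hx; simp [hx]
    rcases hv with rfl | hv
    · exact Or.inl hus
    · exact Or.inr ⟨u, by simp, hv.symm, hus⟩
  · intro x hx
    refine ⟨by simp [hx], ?_⟩
    have hxu : x ≠ u := hx.ne'
    have := hprop u x huS ((hS x).2 (Or.inr hx)) hx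
    simp only [hxu, if_false]
    intro h
    exact this (Option.some.inj h).symm

theorem statement_4 {V : Type*} [Fintype V] (G : SimpleGraph V)
    (hconn : G.Connected)
    (hC4 : G.IsFreeOf (cycleGraph 4)) (u : V)
    (hu : (G.induce (insert u (G.neighborSet u))).distChromNum ≤ G.maxDeg) :
    G.distChromNum ≤ G.maxDeg + 1 := by
  classical
  have hn : ∀ v, G.degree v ≤ G.maxDeg := by
    intro v
    unfold SimpleGraph.maxDeg
    convert G.degree_le_maxDegree v
  generalize G.maxDeg = n at hn hu ⊢
  obtain ⟨c, hc⟩ := s4_attained (G.induce (insert u (G.neighborSet u)))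
  have huS : u ∈ insert u (G.neighborSet u) := by simp
  let c0 : V → Fin n := fun v =>
    if h : v ∈ insert u (G.neighborSet u) then Fin.castLE hu (c ⟨v, h⟩)
    else Fin.castLE hu (c ⟨u, huS⟩)
  have hc0 : ∀ v (h : v ∈ insert u (G.neighborSet u)), c0 v = Fin.castLE hu (c ⟨v, h⟩) := by
    intro v h
    simp only [c0]
    rw [dif_pos h]
  obtain ⟨D, c1, huD, h1, h2, h3, h4, h5⟩ := s4_base G n u c0
    (by
      intro x y hx hy hxy
      rw [hc0 x hx, hc0 y hy]
      intro h
      have hadj : (G.induce (insert u (G.neighborSet u))).Adj ⟨x, hx⟩ ⟨y, hy⟩ := hxy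
      exact c.valid hadj (Fin.castLE_injective hu h))
    (by
      intro φ hφ
      apply hc φ
      intro v
      have := hφ v
      rw [hc0 _ (φ v).2, hc0 _ v.2] at this
      exact Fin.castLE_injective hu this)
  obtain ⟨c2, k1, ⟨k2, k3⟩, k4⟩ := s4_iter G hconn hC4 n u hn (Fintype.card V) D c1 huD h1 h2 h3
    (by omega)
  have hprop : ∀ x y, G.Adj x y → c2 x ≠ c2 y := fun x y h => k2 x (by simp) y (by simp) h
  apply Nat.sInf_le
  let e : Option (Fin n) ≃ Fin (n + 1) := (finSuccEquiv n).symm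
  refine ⟨Coloring.mk (fun v => e (c2 v)) (fun h he => hprop _ _ h (e.injective he)), ?_⟩
  intro φ hφ
  have hφ' : ∀ v, c2 (φ v) = c2 v := fun v => e.injective (hφ v)
  have hu2 : φ u = u := by
    by_contra hne
    have : c2 (φ u) = none := by rw [hφ', k1 u huD, h5]
    obtain ⟨x, _, hx, hcx⟩ := k3 (φ u) (by simp) hne this (c0 u)
    have hx' : G.Adj u (φ.symm x) := by
      rw [← φ.map_adj_iff]
      simpa using hx
    obtain ⟨m1, m2⟩ := h4 _ hx'
    apply m2
    rw [← k1 _ m1, ← hφ', φ.apply_symm_apply, hcx]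
  intro v
  exact k4 c2 hprop (fun _ _ => rfl) φ hφ' hu2 v (by simp)
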